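/- Assume the Littlewood conjecture: for all α, β ∈ ℝ, liminf_{n→∞} n‖nα‖‖nβ‖ = 0, where n ranges over positive integers. Then for every d ≥ 1 and every integer k > d with k ≠ 2d, there is no k to d cubical cut and project set which is LR_Ω with respect to ℛ_d. -/

import Mathlib

noncomputable section

open MeasureTheory Set Filter

/-- The distance from a real number to the nearest integer. -/
def distInt (x : ℝ) : ℝ := |x - round x|

/-- The real vector in `ℝ^k` corresponding to an integer vector. -/
def intVec {k : ℕ} (n : Fin k → ℤ) : Fin k → ℝ := fun i => (n i : ℝ)

/-- The embedding of `ℝ^d` into `ℝ^k` as the span of the first `d` coordinates. -/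
def emb (k d : ℕ) (x : Fin d → ℝ) : Fin k → ℝ :=
  fun i => if h : (i : ℕ) < d then x ⟨i, h⟩ else 0

/-- A `k` to `d` cut and project scheme: a totally irrational `d`-dimensional subspace
`E ⊆ ℝ^k`, the projection `proj = π` onto `E` along a complementary subspace `F_π`
(injective on `ℤ^k`), the projection `rho = ρ` onto `E` with respect to the decomposition
`ℝ^k = E + F_ρ` where `F_ρ = {0} × ℝ^{k-d}`, a window `W ⊆ F_ρ`, and a point `s`
(a representative of a point of `ℝ^k/ℤ^k`). -/
structure CPS (k d : ℕ) where
  E : Submodule ℝ (Fin k → ℝ)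
  rank_E : Module.finrank ℝ E = d
  /-- `E` is totally irrational: its image in `ℝ^k/ℤ^k` is dense,
  equivalently `E + ℤ^k` is dense in `ℝ^k`. -/
  totallyIrrational : Dense {x : Fin k → ℝ | ∃ e ∈ E, ∃ n : Fin k → ℤ, x = e + intVec n}
  /-- `π`, the projection onto `E` along a complementary subspace `F_π = ker proj`. -/
  proj : (Fin k → ℝ) →ₗ[ℝ] (Fin k → ℝ)
  proj_mem : ∀ x, proj x ∈ E
  proj_id : ∀ x ∈ E, proj x = x
  /-- `π` is injective on `ℤ^k`. -/
  proj_inj : ∀ m n : Fin k → ℤ, proj (intVec m) = proj (intVec n) → m = n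
  /-- `ρ`, the projection onto `E` with respect to the decomposition `ℝ^k = E + F_ρ`. -/
  rho : (Fin k → ℝ) →ₗ[ℝ] (Fin k → ℝ)
  rho_mem : ∀ x, rho x ∈ E
  /-- `x - ρ(x) ∈ F_ρ = {0} × ℝ^{k-d}`; in particular `ρ* = id - ρ` maps into `F_ρ`. -/
  rho_decomp : ∀ (x : Fin k → ℝ) (i : Fin k), (i : ℕ) < d → x i - rho x i = 0
  /-- The window `W ⊆ F_ρ`. -/
  window : Set (Fin k → ℝ)
  window_sub : ∀ x ∈ window, ∀ i : Fin k, (i : ℕ) < d → x i = 0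
  /-- A representative of the point `s ∈ ℝ^k/ℤ^k`. -/
  s : Fin k → ℝ

namespace CPS

variable {k d : ℕ} (𝒟 : CPS k d)

/-- `ρ* : ℝ^k → F_ρ`, the projection onto `F_ρ` along `E`. -/
def rhoStar (x : Fin k → ℝ) : Fin k → ℝ := x - 𝒟.rho x

/-- The strip `S = W + E`. -/
def strip : Set (Fin k → ℝ) := {z | ∃ w ∈ 𝒟.window, ∃ e ∈ (𝒟.E : Set (Fin k → ℝ)), z = w + e}

/-- The cut and project set `Y = π(S ∩ (ℤ^k + s))`. -/
def Y : Set (Fin k → ℝ) :=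
  𝒟.proj '' (𝒟.strip ∩ {z | ∃ n : Fin k → ℤ, z = intVec n + 𝒟.s})

/-- `s` is regular: `ℤ^k + s` does not meet the boundary of the strip. -/
def Regular : Prop := ∀ n : Fin k → ℤ, intVec n + 𝒟.s ∉ frontier 𝒟.strip

/-- `Y` is aperiodic: its group of periods is trivial. -/
def Aperiodic : Prop := ∀ x ∈ (𝒟.E : Set (Fin k → ℝ)),
  {z | ∃ y ∈ 𝒟.Y, z = y + x} = 𝒟.Y → x = 0

/-- The window is the cubical window `{Σ_{i=d+1}^k t_i e_i : 0 ≤ t_i < 1}`. -/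
def IsCubical : Prop :=
  𝒟.window = {x : Fin k → ℝ | ∀ i : Fin k,
    if (i : ℕ) < d then x i = 0 else 0 ≤ x i ∧ x i < 1}

/-- The window is the canonical window `ρ*([0,1]^k)`. -/
def IsCanonical : Prop :=
  𝒟.window = 𝒟.rhoStar '' {x : Fin k → ℝ | ∀ i, x i ∈ Icc (0 : ℝ) 1}

/-- `Y` is a cubical cut and project set: totally irrational (a field of `CPS`),
regular, aperiodic, and formed with the cubical window. -/
def IsCubicalCPSet : Prop := 𝒟.IsCubical ∧ 𝒟.Regular ∧ 𝒟.Aperiodic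

/-- `Y` is a canonical cut and project set. -/
def IsCanonicalCPSet : Prop := 𝒟.IsCanonical ∧ 𝒟.Regular ∧ 𝒟.Aperiodic

/-- For `y ∈ Y`, the (unique, by injectivity of `π` on `ℤ^k`) integer vector `ỹ`
with `ỹ + s ∈ S` and `π(ỹ + s) = y`. -/
def intRep (y : Fin k → ℝ) : Fin k → ℤ :=
  Classical.epsilon fun n : Fin k → ℤ =>
    intVec n + 𝒟.s ∈ 𝒟.strip ∧ 𝒟.proj (intVec n + 𝒟.s) = y

/-- The patch of shape `Ω` at `y`: `P(y,Ω) = {y' ∈ Y : ρ(ỹ' - ỹ) ∈ ρ(Ω)}`,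
where `Ω ⊆ ℝ^d` is viewed inside `⟨e₁,…,e_d⟩_ℝ ⊆ ℝ^k`. -/
def patch (Ω : Set (Fin d → ℝ)) (y : Fin k → ℝ) : Set (Fin k → ℝ) :=
  {y' | y' ∈ 𝒟.Y ∧
    𝒟.rho (intVec (𝒟.intRep y') - intVec (𝒟.intRep y)) ∈ 𝒟.rho '' (emb k d '' Ω)}

/-- Two patches of shape `Ω` are equivalent if they agree up to the translation
taking one distinguished point to the other. -/
def PatchEquiv (Ω : Set (Fin d → ℝ)) (y₁ y₂ : Fin k → ℝ) : Prop :=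
  𝒟.patch Ω y₁ = {z | ∃ w ∈ 𝒟.patch Ω y₂, z = w + (y₁ - y₂)}

/-- The pattern (equivalence class) of the patch of shape `Ω` at `y` occurs in the
region `R ⊆ E`: some point `y' ∈ Y ∩ R` has patch equivalent to that at `y`. -/
def OccursIn (Ω : Set (Fin d → ℝ)) (y : Fin k → ℝ) (R : Set (Fin k → ℝ)) : Prop :=
  ∃ y' ∈ 𝒟.Y ∩ R, 𝒟.PatchEquiv Ω y' y

/-- `Y` is linearly repetitive with respect to a collection `𝒜` of shapes in `ℝ^d`:
there is `C > 0` such that for every `Ω ∈ 𝒜`, every pattern of shape `Ω` occurring in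
`Y` occurs in every ball in `E` of volume `C·|Ω|` (balls in `E` being images under the
identification `ρ ∘ emb : ℝ^d ≅ E` of balls in `ℝ^d`). -/
def IsLR (𝒜 : Set (Set (Fin d → ℝ))) : Prop :=
  ∃ C > (0 : ℝ), ∀ Ω ∈ 𝒜, ∀ y ∈ 𝒟.Y, ∀ (x : Fin d → ℝ) (r : ℝ),
    volume (Metric.closedBall x r) = ENNReal.ofReal C * volume Ω →
    𝒟.OccursIn Ω y (𝒟.rho '' (emb k d '' Metric.closedBall x r))

/-- `Y` is `LR_Ω` with respect to a collection `𝒜` of shapes in `ℝ^d`: there is `C > 0`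
such that for every `Ω ∈ 𝒜`, every pattern of shape `Ω` occurring in `Y` occurs in every
translate of `C·Ω`. -/
def IsLROmega (𝒜 : Set (Set (Fin d → ℝ))) : Prop :=
  ∃ C > (0 : ℝ), ∀ Ω ∈ 𝒜, ∀ y ∈ 𝒟.Y, ∀ x : Fin d → ℝ,
    𝒟.OccursIn Ω y (𝒟.rho '' (emb k d '' {z | ∃ w ∈ Ω, z = x + C • w}))

end CPS

/-- `ℛ_d`: aligned rectangles in `ℝ^d` with integer vertices and nonempty interior. -/
def RdCollection (d : ℕ) : Set (Set (Fin d → ℝ)) :=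
  {Ω | ∃ a b : Fin d → ℤ, (∀ i, a i < b i) ∧
    Ω = {x : Fin d → ℝ | ∀ i, (a i : ℝ) ≤ x i ∧ x i ≤ (b i : ℝ)}}

/-- `𝒞_d`: convex polytopes in `ℝ^d` with vertices in `ℤ^d` and nonempty interior. -/
def CdCollection (d : ℕ) : Set (Set (Fin d → ℝ)) :=
  {Ω | (∃ V : Finset (Fin d → ℤ),
      Ω = convexHull ℝ ((fun n : Fin d → ℤ => intVec n) '' (V : Set (Fin d → ℤ)))) ∧
    (interior Ω).Nonempty}

namespace LWProof

/-- The linear form. -/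
def Lf {d r : ℕ} (α : Fin r → Fin d → ℝ) (m : Fin d → ℤ) (i : Fin r) : ℝ :=
  ∑ j, α i j * (m j : ℝ)

/-- internal coordinate -/
def Xc {d r : ℕ} (α : Fin r → Fin d → ℝ) (c : Fin r → ℝ) (a : Fin d → ℤ) (i : Fin r) : ℝ :=
  Int.fract (c i - Lf α a i)

lemma Lf_add {d r : ℕ} (α : Fin r → Fin d → ℝ) (m n : Fin d → ℤ) (i : Fin r) :
    Lf α (m + n) i = Lf α m i + Lf α n i := by
  simp [Lf, mul_add, Finset.sum_add_distrib]

/-- projection on internal coordinates along the graph of `α` -/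
def gmap {d r : ℕ} (α : Fin r → Fin d → ℝ) : (Fin (d + r) → ℝ) →ₗ[ℝ] (Fin r → ℝ) where
  toFun z := fun i => z (Fin.natAdd d i) - ∑ j, α i j * z (Fin.castAdd r j)
  map_add' x y := by
    ext i
    simp [mul_add, Finset.sum_add_distrib]; ring
  map_smul' t x := by
    ext i
    simp only [Pi.smul_apply, smul_eq_mul, RingHom.id_apply, mul_sub, Finset.mul_sum]
    congr 1
    apply Finset.sum_congr rfl
    intro j _
    ring

lemma gmap_apply {d r : ℕ} (α : Fin r → Fin d → ℝ) (z : Fin (d + r) → ℝ) (i : Fin r) :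
    gmap α z i = z (Fin.natAdd d i) - ∑ j, α i j * z (Fin.castAdd r j) := rfl

lemma exists_graph {d r : ℕ} (𝒟 : CPS (d + r) d) :
    ∃ α : Fin r → Fin d → ℝ, ∀ v, v ∈ 𝒟.E ↔ gmap α v = 0 := by
  let R : (Fin (d + r) → ℝ) →ₗ[ℝ] (Fin d → ℝ) := LinearMap.funLeft ℝ ℝ (Fin.castAdd r)
  have hRrho : ∀ v, R (𝒟.rho v) = R v := by
    intro v
    ext j
    have := 𝒟.rho_decomp v (Fin.castAdd r j) (by simp)
    simp only [R, LinearMap.funLeft_apply]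
    linarith
  let RE : 𝒟.E →ₗ[ℝ] (Fin d → ℝ) := R.comp 𝒟.E.subtype
  have hsurj : Function.Surjective RE := by
    intro x
    refine ⟨⟨𝒟.rho (Fin.append x 0), 𝒟.rho_mem _⟩, ?_⟩
    show R (𝒟.rho _) = x
    rw [hRrho]
    ext j
    simp [R, LinearMap.funLeft_apply]
  have hinj : Function.Injective RE := by
    refine (LinearMap.injective_iff_surjective_of_finrank_eq_finrank ?_).2 hsurj
    rw [𝒟.rank_E]; simp
  have hinj' : ∀ v ∈ 𝒟.E, ∀ w ∈ 𝒟.E, R v = R w → v = w := by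
    intro v hv w hw h
    have := @hinj ⟨v, hv⟩ ⟨w, hw⟩ h
    simpa using this
  let bv : Fin d → Fin (d + r) → ℝ := fun j => 𝒟.rho (Pi.single (Fin.castAdd r j) 1)
  let wv : (Fin d → ℝ) → Fin (d + r) → ℝ := fun x => ∑ j, x j • bv j
  have hwE : ∀ x, wv x ∈ 𝒟.E := fun x =>
    Submodule.sum_mem _ fun j _ => Submodule.smul_mem _ _ (𝒟.rho_mem _)
  have hwR : ∀ x, R (wv x) = x := by
    intro x
    simp only [wv, bv, map_sum, map_smul, hRrho]
    ext j
    simp [R, LinearMap.funLeft_apply, Pi.single_apply, Finset.sum_apply]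
  refine ⟨fun i j => bv j (Fin.natAdd d i), ?_⟩
  have hwg : ∀ x i, wv x (Fin.natAdd d i) = ∑ j, bv j (Fin.natAdd d i) * x j := by
    intro x i
    simp [wv, Finset.sum_apply, mul_comm]
  intro v
  constructor
  · intro hv
    have h1 : v = wv (R v) := hinj' v hv _ (hwE _) (hwR _).symm
    ext i
    rw [gmap_apply]
    have h2 := hwg (R v) i
    rw [← h1] at h2
    rw [h2]
    simp [R, LinearMap.funLeft_apply]
  · intro hg
    have h1 : v = wv (R v) := by
      ext l
      refine Fin.addCases (fun j => ?_) (fun i => ?_) l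
      · have := congrFun (hwR (R v)) j
        simpa [R, LinearMap.funLeft_apply] using this.symm
      · rw [hwg]
        have := congrFun hg i
        rw [gmap_apply] at this
        simp only [Pi.zero_apply] at this
        simp only [R, LinearMap.funLeft_apply]
        linarith
    rw [h1]; exact hwE _

section graph
variable {d r : ℕ} (𝒟 : CPS (d + r) d) {α : Fin r → Fin d → ℝ}

lemma dens (hα : ∀ v, v ∈ 𝒟.E ↔ gmap α v = 0) (t : Fin r → ℝ) (ε : ℝ) (hε : 0 < ε) :
    ∃ (m : Fin d → ℤ) (p : Fin r → ℤ), ∀ i, |(p i : ℝ) - Lf α m i - t i| < ε := by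
  have hsurj : Function.Surjective (gmap α) := by
    intro u
    refine ⟨Fin.append 0 u, ?_⟩
    ext i
    simp [gmap_apply]
  have hcont : Continuous (gmap α) := LinearMap.continuous_of_finiteDimensional _
  have hd := hsurj.denseRange.dense_image hcont 𝒟.totallyIrrational
  obtain ⟨u, hu, hdist⟩ := hd.exists_dist_lt t hε
  obtain ⟨v, ⟨e, he, n, rfl⟩, rfl⟩ := hu
  refine ⟨fun j => n (Fin.castAdd r j), fun i => n (Fin.natAdd d i), fun i => ?_⟩
  rw [map_add, (hα e).1 he, zero_add, dist_comm] at hdist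
  have := (dist_le_pi_dist (gmap α (intVec n)) t i).trans_lt hdist
  rw [Real.dist_eq, gmap_apply] at this
  simpa [intVec, Lf] using this

lemma strip_iff (hα : ∀ v, v ∈ 𝒟.E ↔ gmap α v = 0) (hc : 𝒟.IsCubical) (z : Fin (d + r) → ℝ) :
    z ∈ 𝒟.strip ↔ ∀ i, 0 ≤ gmap α z i ∧ gmap α z i < 1 := by
  unfold CPS.strip
  rw [hc]
  constructor
  · rintro ⟨w, hw, e, he, rfl⟩ i
    rw [map_add, (hα e).1 he, add_zero, gmap_apply]
    have h0 : ∀ j : Fin d, w (Fin.castAdd r j) = 0 := by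
      intro j
      have := hw (Fin.castAdd r j)
      simpa using this
    have h1 := hw (Fin.natAdd d i)
    simp only [h0, mul_zero, Finset.sum_const_zero, sub_zero]
    simpa using h1
  · intro h
    refine ⟨Fin.append 0 (gmap α z), ?_, z - Fin.append 0 (gmap α z), ?_, by simp⟩
    · intro l
      refine Fin.addCases (fun j => ?_) (fun i => ?_) l
      · simp
      · simpa using h i
    · show _ ∈ 𝒟.E
      rw [hα, map_sub]
      ext i
      simp [gmap_apply]

lemma aper (hα : ∀ v, v ∈ 𝒟.E ↔ gmap α v = 0) (hc : 𝒟.IsCubical) (ha : 𝒟.Aperiodic)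
    (m : Fin d → ℤ) (hm : ∀ i, ∃ p : ℤ, Lf α m i = p) : m = 0 := by
  choose p hp using hm
  let n : Fin (d + r) → ℤ := Fin.append m p
  have hn : gmap α (intVec n) = 0 := by
    ext i
    rw [gmap_apply]
    have := hp i
    simp only [Lf] at this
    simp [intVec, n, this]
  have hE : intVec n ∈ 𝒟.E := (hα _).2 hn
  have hneg : ∀ a b : Fin (d + r) → ℤ, intVec (a + b) = intVec a + intVec b := by
    intro a b; ext; simp [intVec]
  have hsub : ∀ a b : Fin (d + r) → ℤ, intVec (a - b) = intVec a - intVec b := by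
    intro a b; ext; simp [intVec]
  have h0 := ha (intVec n) hE ?_
  · ext j
    have := congrFun h0 (Fin.castAdd r j)
    simpa [intVec, n] using this
  · ext z
    constructor
    · rintro ⟨y, ⟨_, ⟨hz, b, rfl⟩, rfl⟩, rfl⟩
      refine ⟨intVec (b + n) + 𝒟.s, ⟨?_, b + n, rfl⟩, ?_⟩
      · rw [strip_iff 𝒟 hα hc] at hz ⊢
        have : gmap α (intVec (b + n) + 𝒟.s) = gmap α (intVec b + 𝒟.s) := by
          rw [hneg]; simp [hn]
        rwa [this]
      · rw [hneg, add_right_comm, map_add, 𝒟.proj_id _ hE]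
    · rintro ⟨_, ⟨hz, b, rfl⟩, rfl⟩
      refine ⟨_, ⟨intVec (b - n) + 𝒟.s, ⟨?_, b - n, rfl⟩, rfl⟩, ?_⟩
      · rw [strip_iff 𝒟 hα hc] at hz ⊢
        have : gmap α (intVec (b - n) + 𝒟.s) = gmap α (intVec b + 𝒟.s) := by
          rw [hsub]; simp [hn]
        rwa [this]
      · rw [hsub]
        simp only [map_add, map_sub, 𝒟.proj_id _ hE]
        abel

/-- the lattice point over `a` -/
def Np (α : Fin r → Fin d → ℝ) (s : Fin (d + r) → ℝ) (a : Fin d → ℤ) : Fin (d + r) → ℤ :=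
  Fin.append a fun i => -⌊gmap α s i - Lf α a i⌋

lemma gmap_Np (s : Fin (d + r) → ℝ) (a : Fin d → ℤ) :
    gmap α (intVec (Np α s a) + s) = Xc α (gmap α s) a := by
  ext i
  rw [map_add, Pi.add_apply, gmap_apply]
  simp only [intVec, Np, Fin.append_left, Fin.append_right, Xc, Int.fract]
  push_cast
  simp only [Lf]
  ring

lemma eq_Np (s : Fin (d + r) → ℝ) (n : Fin (d + r) → ℤ)
    (h : ∀ i, 0 ≤ gmap α (intVec n + s) i ∧ gmap α (intVec n + s) i < 1) :
    n = Np α s (fun j => n (Fin.castAdd r j)) := by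
  ext l
  refine Fin.addCases (fun j => ?_) (fun i => ?_) l
  · simp [Np]
  · have hi := h i
    rw [map_add, Pi.add_apply, gmap_apply] at hi
    simp only [intVec] at hi
    simp only [Np, Fin.append_right, Lf]
    have : ⌊gmap α s i - ∑ j, α i j * ((n (Fin.castAdd r j) : ℤ) : ℝ)⌋ = -n (Fin.natAdd d i) := by
      rw [Int.floor_eq_iff]
      push_cast
      constructor <;> linarith [hi.1, hi.2]
    rw [this]; ring

end graph
section lr
variable {d r : ℕ} (𝒟 : CPS (d + r) d) {α : Fin r → Fin d → ℝ}

lemma rho_fst (v : Fin (d + r) → ℝ) (j : Fin d) :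
    𝒟.rho v (Fin.castAdd r j) = v (Fin.castAdd r j) := by
  have := 𝒟.rho_decomp v (Fin.castAdd r j) (by simp)
  linarith

lemma eq_of_fst (hα : ∀ v, v ∈ 𝒟.E ↔ gmap α v = 0) (v w : Fin (d + r) → ℝ)
    (hv : v ∈ 𝒟.E) (hw : w ∈ 𝒟.E)
    (h : ∀ j, v (Fin.castAdd r j) = w (Fin.castAdd r j)) : v = w := by
  rw [hα] at hv hw
  ext l
  refine Fin.addCases (fun j => h j) (fun i => ?_) l
  have h1 := congrFun hv i
  have h2 := congrFun hw i
  rw [gmap_apply] at h1 h2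
  simp only [h, Pi.zero_apply] at h1 h2
  linarith

lemma intRep_eq (n : Fin (d + r) → ℤ) (hn : intVec n + 𝒟.s ∈ 𝒟.strip) :
    𝒟.intRep (𝒟.proj (intVec n + 𝒟.s)) = n := by
  have := Classical.epsilon_spec (p := fun m : Fin (d + r) → ℤ =>
    intVec m + 𝒟.s ∈ 𝒟.strip ∧ 𝒟.proj (intVec m + 𝒟.s) = 𝒟.proj (intVec n + 𝒟.s)) ⟨n, hn, rfl⟩
  have aux : ∀ m, 𝒟.proj (intVec m + 𝒟.s) = 𝒟.proj (intVec n + 𝒟.s) → m = n := by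
    intro m h2
    rw [map_add, map_add] at h2
    exact 𝒟.proj_inj _ _ (add_right_cancel h2)
  exact aux _ this.2

lemma Np_strip (hα : ∀ v, v ∈ 𝒟.E ↔ gmap α v = 0) (hc : 𝒟.IsCubical) (a : Fin d → ℤ) :
    intVec (Np α 𝒟.s a) + 𝒟.s ∈ 𝒟.strip := by
  rw [strip_iff 𝒟 hα hc, gmap_Np]
  exact fun i => ⟨Int.fract_nonneg _, Int.fract_lt_one _⟩

lemma emb_castAdd (x : Fin d → ℝ) (j : Fin d) : emb (d + r) d x (Fin.castAdd r j) = x j := by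
  simp [emb]

lemma mem_Y (hα : ∀ v, v ∈ 𝒟.E ↔ gmap α v = 0) (hc : 𝒟.IsCubical) (y : Fin (d + r) → ℝ) :
    y ∈ 𝒟.Y ↔ ∃ a, y = 𝒟.proj (intVec (Np α 𝒟.s a) + 𝒟.s) := by
  constructor
  · rintro ⟨_, ⟨hz, n, rfl⟩, rfl⟩
    rw [strip_iff 𝒟 hα hc] at hz
    exact ⟨_, by rw [← eq_Np 𝒟.s n hz]⟩
  · rintro ⟨a, rfl⟩
    exact ⟨_, ⟨Np_strip 𝒟 hα hc a, _, rfl⟩, rfl⟩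

lemma intVec_add {k : ℕ} (a b : Fin k → ℤ) : intVec (a + b) = intVec a + intVec b := by
  ext; simp [intVec]

lemma intVec_sub {k : ℕ} (a b : Fin k → ℤ) : intVec (a - b) = intVec a - intVec b := by
  ext; simp [intVec]

lemma patch_shift (hα : ∀ v, v ∈ 𝒟.E ↔ gmap α v = 0) (hc : 𝒟.IsCubical)
    (Ω : Set (Fin d → ℝ)) (a a' m : Fin d → ℤ) (hm : intVec m ∈ Ω)
    (he : 𝒟.PatchEquiv Ω (𝒟.proj (intVec (Np α 𝒟.s a') + 𝒟.s))
      (𝒟.proj (intVec (Np α 𝒟.s a) + 𝒟.s))) (i : Fin r) :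
    Xc α (gmap α 𝒟.s) (a' + m) i - Xc α (gmap α 𝒟.s) a' i
      = Xc α (gmap α 𝒟.s) (a + m) i - Xc α (gmap α 𝒟.s) a i := by
  set s := 𝒟.s with hs
  have h1 : 𝒟.proj (intVec (Np α s (a + m)) + s) ∈ 𝒟.patch Ω (𝒟.proj (intVec (Np α s a) + s)) := by
    refine ⟨(mem_Y 𝒟 hα hc _).2 ⟨_, rfl⟩, ?_⟩
    rw [hs, intRep_eq 𝒟 _ (Np_strip 𝒟 hα hc _), intRep_eq 𝒟 _ (Np_strip 𝒟 hα hc _)]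
    refine ⟨_, ⟨_, hm, rfl⟩, ?_⟩
    refine eq_of_fst 𝒟 hα _ _ (𝒟.rho_mem _) (𝒟.rho_mem _) fun j => ?_
    rw [rho_fst, rho_fst, emb_castAdd]
    simp [intVec, Np]
  have h2 : 𝒟.proj (intVec (Np α s (a + m)) + s) +
      (𝒟.proj (intVec (Np α s a') + s) - 𝒟.proj (intVec (Np α s a) + s)) ∈
      𝒟.patch Ω (𝒟.proj (intVec (Np α s a') + s)) := by
    rw [he]
    exact ⟨_, h1, rfl⟩
  obtain ⟨b, hb⟩ := (mem_Y 𝒟 hα hc _).1 h2.1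
  have h3 : Np α s (a + m) + Np α s a' - Np α s a = Np α s b := by
    apply 𝒟.proj_inj
    rw [intVec_sub, intVec_add]
    simp only [map_add, map_sub] at hb ⊢
    rw [← hs] at hb
    have := hb
    rw [← sub_eq_zero] at this ⊢
    rw [← this]
    abel
  have h4 : b = a' + m := by
    ext j
    have := congrFun h3 (Fin.castAdd r j)
    simp [Np] at this
    simp [← this]; ring
  subst h4
  have h5 : gmap α (intVec (Np α s (a + m)) + s) + gmap α (intVec (Np α s a') + s)
      - gmap α (intVec (Np α s a) + s) = gmap α (intVec (Np α s (a' + m)) + s) := by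
    rw [← h3, intVec_sub, intVec_add]
    simp only [map_add, map_sub]
    abel
  rw [gmap_Np, gmap_Np, gmap_Np, gmap_Np] at h5
  have := congrFun h5 i
  simp only [Pi.sub_apply, Pi.add_apply] at this
  linarith

lemma lr_main (hα : ∀ v, v ∈ 𝒟.E ↔ gmap α v = 0) (hc : 𝒟.IsCubical)
    (hLR : 𝒟.IsLROmega (RdCollection d)) :
    ∃ C B : ℝ, 0 ≤ C ∧ 0 ≤ B ∧ ∀ M : Fin d → ℕ, (∀ j, 1 ≤ M j) → ∀ a : Fin d → ℤ,
      ∀ x : Fin d → ℝ, ∃ a' : Fin d → ℤ, (∀ j, |(a' j : ℝ) - x j| ≤ C * M j + B) ∧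
        ∀ m : Fin d → ℤ, (∀ j, |m j| ≤ M j) → ∀ i,
          Xc α (gmap α 𝒟.s) (a' + m) i - Xc α (gmap α 𝒟.s) a' i
            = Xc α (gmap α 𝒟.s) (a + m) i - Xc α (gmap α 𝒟.s) a i := by
  obtain ⟨C, hC, hLR⟩ := hLR
  let P := LinearMap.toContinuousLinearMap 𝒟.proj
  refine ⟨C, ‖P‖, hC.le, norm_nonneg _, fun M hM a x => ?_⟩
  obtain ⟨y', ⟨hy', hR⟩, he⟩ := hLR {x : Fin d → ℝ | ∀ i, ((-(M i : ℤ) : ℤ) : ℝ) ≤ x i ∧ x i ≤ ((M i : ℤ) : ℝ)}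
    ⟨fun i => -(M i : ℤ), fun i => (M i : ℤ), fun i => by have := hM i; simp only []; omega, rfl⟩
    (𝒟.proj (intVec (Np α 𝒟.s a) + 𝒟.s)) ((mem_Y 𝒟 hα hc _).2 ⟨_, rfl⟩)
    (fun j => x j + 𝒟.s (Fin.castAdd r j))
  obtain ⟨a', rfl⟩ := (mem_Y 𝒟 hα hc _).1 hy'
  refine ⟨a', fun j => ?_, fun m hm i => patch_shift 𝒟 hα hc _ a a' m ?_ he i⟩
  · obtain ⟨_, ⟨_, ⟨w, hw, rfl⟩, rfl⟩, hz⟩ := hR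
    have h1 := congrFun hz (Fin.castAdd r j)
    rw [rho_fst, emb_castAdd] at h1
    simp only [Pi.add_apply, Pi.smul_apply, smul_eq_mul] at h1
    set z := intVec (Np α 𝒟.s a') + 𝒟.s with hzdef
    have hzj : z (Fin.castAdd r j) = a' j + 𝒟.s (Fin.castAdd r j) := by
      simp [hzdef, intVec, Np]
    have hgz := gmap_Np (α := α) 𝒟.s a'
    rw [← hzdef] at hgz
    have hsplit : 𝒟.proj z = 𝒟.rho z + 𝒟.proj (z - 𝒟.rho z) := by
      rw [map_sub, 𝒟.proj_id _ (𝒟.rho_mem z)]; abel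
    have hn : ‖z - 𝒟.rho z‖ ≤ 1 := by
      rw [pi_norm_le_iff_of_nonneg zero_le_one]
      intro l
      refine Fin.addCases (fun j => ?_) (fun i => ?_) l
      · simp [rho_fst]
      · have h2 := congrFun ((hα _).1 (𝒟.rho_mem z)) i
        have h3 := congrFun hgz i
        rw [gmap_apply] at h2 h3
        simp only [rho_fst, Pi.zero_apply] at h2
        have : (z - 𝒟.rho z) (Fin.natAdd d i) = Xc α (gmap α 𝒟.s) a' i := by
          rw [← h3, Pi.sub_apply]; linarith
        rw [this, Real.norm_eq_abs, abs_le]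
        have h4 := Int.fract_nonneg (gmap α 𝒟.s i - Lf α a' i)
        have h5 := Int.fract_lt_one (gmap α 𝒟.s i - Lf α a' i)
        simp only [Xc]
        constructor <;> linarith
    have hb : |𝒟.proj (z - 𝒟.rho z) (Fin.castAdd r j)| ≤ ‖P‖ := by
      have h6 := P.le_opNorm (z - 𝒟.rho z)
      have h7 := norm_le_pi_norm (P (z - 𝒟.rho z)) (Fin.castAdd r j)
      have h8 : ‖P‖ * ‖z - 𝒟.rho z‖ ≤ ‖P‖ * 1 := by gcongr
      simp only [P, LinearMap.coe_toContinuousLinearMap', Real.norm_eq_abs] at h6 h7 h8 ⊢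
      linarith
    rw [hsplit, Pi.add_apply, rho_fst, hzj] at h1
    have hwj := hw j
    push_cast at hwj
    have hc1 : C * w j ≤ C * M j := by gcongr; exact hwj.2
    have hc2 : C * -(M j : ℝ) ≤ C * w j := by gcongr; exact hwj.1
    rw [abs_le] at hb ⊢
    constructor <;> linarith [hb.1, hb.2]
  · intro j
    have := abs_le.1 (hm j)
    simp only [intVec]
    exact ⟨by exact_mod_cast this.1, by exact_mod_cast this.2⟩

end lr
lemma fract_eq_of (x y : ℝ) (z : ℤ) (h : x = y + z) (h0 : 0 ≤ y) (h1 : y < 1) :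
    Int.fract x = y := by
  rw [Int.fract_eq_iff]
  exact ⟨h0, h1, z, by rw [h]; ring⟩

lemma key {d r : ℕ} (α : Fin r → Fin d → ℝ) (c : Fin r → ℝ)
    (hD : ∀ (t : Fin r → ℝ) (ε : ℝ), 0 < ε →
      ∃ (m : Fin d → ℤ) (p : Fin r → ℤ), ∀ i, |(p i : ℝ) - Lf α m i - t i| < ε)
    (hLR : ∃ C B : ℝ, 0 ≤ C ∧ 0 ≤ B ∧ ∀ M : Fin d → ℕ, (∀ j, 1 ≤ M j) → ∀ a : Fin d → ℤ,
      ∀ x : Fin d → ℝ, ∃ a' : Fin d → ℤ, (∀ j, |(a' j : ℝ) - x j| ≤ C * M j + B) ∧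
        ∀ m : Fin d → ℤ, (∀ j, |m j| ≤ M j) → ∀ i,
          Xc α c (a' + m) i - Xc α c a' i = Xc α c (a + m) i - Xc α c a i) :
    ∃ K : ℝ, 0 < K ∧ ∀ M : Fin d → ℕ, (∀ j, 1 ≤ M j) → ∀ q : Fin r → ℕ, (∀ i, 1 ≤ q i) →
      (∀ i, q i = 1 ∨ ∃ m : Fin d → ℤ, (∀ j, |m j| ≤ M j) ∧ 0 < Int.fract (-Lf α m i) ∧
        2 * q i * Int.fract (-Lf α m i) ≤ 1) →
      ∏ i, (q i : ℝ) ≤ K * ∏ j, (M j : ℝ) := by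
  obtain ⟨C, B, hC, hB, hLR⟩ := hLR
  refine ⟨(2 * C + 2 * B + 1) ^ d, by positivity, fun M hM q hq hqm => ?_⟩
  have hτ : ∀ i, ∃ τ : ℝ, 0 < τ ∧ (q i = 1 ∨ (2 * q i * τ ≤ 1 ∧ ∃ m : Fin d → ℤ,
      (∀ j, |m j| ≤ M j) ∧ τ = Int.fract (-Lf α m i))) := by
    intro i
    rcases hqm i with h | ⟨m, hm, h0, h1⟩
    · exact ⟨1, one_pos, Or.inl h⟩
    · exact ⟨_, h0, Or.inr ⟨h1, m, hm, rfl⟩⟩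
  choose τ hτ0 hτ using hτ
  obtain ⟨δ, hδτ, hδ0, hδ1⟩ : ∃ δ : ℝ, (∀ i, δ < τ i) ∧ 0 < δ ∧ δ < 1 := by
    have h1 : ∀ᶠ δ in nhdsWithin (0 : ℝ) (Ioi 0), ∀ i, δ < τ i := by
      rw [eventually_all]
      intro i
      filter_upwards [Ioo_mem_nhdsGT (hτ0 i)] with x hx using hx.2
    have h2 : ∀ᶠ δ in nhdsWithin (0 : ℝ) (Ioi 0), 0 < δ ∧ δ < 1 := by
      filter_upwards [Ioo_mem_nhdsGT (one_pos (α := ℝ))] with x hx using hx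
    exact (h1.and h2).exists
  have hX0 : ∀ a i, 0 ≤ Xc α c a i := fun a i => Int.fract_nonneg _
  have hX1 : ∀ a i, Xc α c a i < 1 := fun a i => Int.fract_lt_one _
  have hXz : ∀ a i, ∃ z : ℤ, c i - Lf α a i = Xc α c a i + z := fun a i =>
    ⟨⌊c i - Lf α a i⌋, (Int.fract_add_floor _).symm⟩
  -- base point
  obtain ⟨a0, p0, h0⟩ := hD (fun i => 1 - δ / 2 - c i) (δ / 2) (by linarith)
  have ha0 : ∀ i, 1 - τ i ≤ Xc α c a0 i := by
    intro i
    have h := abs_lt.1 (h0 i)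
    have h1 : Xc α c a0 i = c i - Lf α a0 i + p0 i := by
      apply fract_eq_of _ _ (-p0 i)
      · push_cast; ring
      · linarith [h.1]
      · linarith [h.2]
    rw [h1]
    linarith [h.1, hδτ i]
  have hs : ∀ s : (∀ i, Fin (q i)), ∃ b : Fin d → ℤ, (∀ j, |(b j : ℝ)| ≤ C * M j + B) ∧
      ∀ i, ((s i : ℕ) : ℝ) / q i ≤ Xc α c b i ∧ Xc α c b i < (((s i : ℕ) : ℝ) + 1) / q i := by
    intro s
    obtain ⟨ms, ps, hms⟩ := hD (fun i => ((s i : ℕ) : ℝ) / q i + τ i + δ / 2) (δ / 2) (by linarith)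
    obtain ⟨a', ha', hsh⟩ := hLR M hM a0 (fun j => -(ms j : ℝ))
    refine ⟨a' + ms, fun j => ?_, fun i => ?_⟩
    · have := ha' j
      simpa using this
    · rcases hτ i with h1 | ⟨h2, m, hm, hmτ⟩
      · have hsi : (s i : ℕ) = 0 := by have := (s i).2; omega
        simp only [hsi, h1]
        have := hX0 (a' + ms) i
        have := hX1 (a' + ms) i
        constructor <;> simp <;> linarith
      · have hqpos : (0 : ℝ) < q i := by exact_mod_cast hq i
        have e1 : Xc α c (a0 + m) i = Xc α c a0 i + τ i - 1 := by
          obtain ⟨z, hz⟩ := hXz a0 i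
          have hf := Int.fract_add_floor (-Lf α m i)
          rw [← hmτ] at hf
          apply fract_eq_of _ _ (z + ⌊-Lf α m i⌋ + 1)
          · rw [Lf_add]; push_cast; linarith
          · linarith [ha0 i]
          · have : τ i < 1 := by rw [hmτ]; exact Int.fract_lt_one _
            linarith [hX1 a0 i]
        have e2 : 1 - τ i ≤ Xc α c a' i := by
          have := hsh m hm i
          rw [e1] at this
          linarith [hX0 (a' + m) i]
        have h := abs_lt.1 (hms i)
        have hs0 : (0 : ℝ) ≤ ((s i : ℕ) : ℝ) / q i := by positivity
        have hs1 : (((s i : ℕ) : ℝ) + 1) / q i ≤ 1 := by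
          rw [div_le_one hqpos]
          exact_mod_cast (s i).2
        have hs2 : (((s i : ℕ) : ℝ) + 1) / q i = ((s i : ℕ) : ℝ) / q i + 1 / q i := by
          rw [add_div]
        have hq2 : 2 * τ i ≤ 1 / q i := by
          rw [le_div_iff₀ hqpos]; linarith
        have hx1 := hX1 a' i
        have hdt := hδτ i
        have e3 : Xc α c (a' + ms) i = Xc α c a' i - 1 + ((ps i : ℝ) - Lf α ms i) := by
          obtain ⟨z, hz⟩ := hXz a' i
          apply fract_eq_of _ _ (z + 1 - ps i)
          · rw [Lf_add]; push_cast; linarith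
          · linarith [h.1]
          · linarith [h.2]
        rw [e3]
        constructor
        · linarith [h.1]
        · linarith [h.2]
  choose b hb hbX using hs
  let H : Fin d → ℤ := fun j => ⌊C * M j + B⌋
  have hinj : Function.Injective b := by
    intro s s' hss
    ext i
    have hqpos : (0 : ℝ) < q i := by exact_mod_cast hq i
    have h1 := hbX s i
    have h2 := hbX s' i
    rw [hss] at h1
    rw [div_le_iff₀ hqpos, lt_div_iff₀ hqpos] at h1 h2
    have h3 : ((s i : ℕ) : ℝ) < (s' i : ℕ) + 1 := by linarith [h1.1, h2.2]
    have h4 : ((s' i : ℕ) : ℝ) < (s i : ℕ) + 1 := by linarith [h1.2, h2.1]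
    have h3' : (s i : ℕ) < (s' i : ℕ) + 1 := by exact_mod_cast h3
    have h4' : (s' i : ℕ) < (s i : ℕ) + 1 := by exact_mod_cast h4
    omega
  have hcard := Finset.card_le_card_of_injOn (s := Finset.univ)
    (t := Fintype.piFinset fun j => Finset.Icc (-H j) (H j)) b (by
      intro s _
      simp only [Finset.mem_coe, Fintype.mem_piFinset, Finset.mem_Icc]
      intro j
      rw [← abs_le]
      apply Int.le_floor.2
      have := hb s j
      exact_mod_cast this) hinj.injOn
  rw [Finset.card_univ, Fintype.card_pi, Fintype.card_piFinset] at hcard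
  simp only [Fintype.card_fin, Int.card_Icc] at hcard
  have hcard' : ∏ i, (q i : ℝ) ≤ ∏ j, (((H j + 1 - -H j).toNat : ℕ) : ℝ) := by exact_mod_cast hcard
  refine hcard'.trans ?_
  have : (2 * C + 2 * B + 1) ^ d * ∏ j, (M j : ℝ) = ∏ j : Fin d, ((2 * C + 2 * B + 1) * (M j : ℝ)) := by
    rw [Finset.prod_mul_distrib]; simp
  rw [this]
  apply Finset.prod_le_prod
  · intro j _; positivity
  · intro j _
    have hM1 : (1 : ℝ) ≤ M j := by exact_mod_cast hM j
    have hH0 : 0 ≤ H j := Int.floor_nonneg.2 (by positivity)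
    have hH : (H j : ℝ) ≤ C * M j + B := Int.floor_le _
    have : (((H j + 1 - -H j).toNat : ℕ) : ℝ) = 2 * H j + 1 := by
      have : (((H j + 1 - -H j).toNat : ℕ) : ℤ) = 2 * H j + 1 := by omega
      exact_mod_cast this
    rw [this]
    nlinarith
lemma distInt_nonneg (x : ℝ) : 0 ≤ distInt x := abs_nonneg _

lemma distInt_le (x : ℝ) (z : ℤ) : distInt x ≤ |x - z| := round_le x z

lemma distInt_pos (x : ℝ) (h : ∀ z : ℤ, x ≠ z) : 0 < distInt x := by
  rw [distInt, abs_pos, sub_ne_zero]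
  exact h _

lemma irr_mul (α : ℝ) (hα : Irrational α) (n : ℕ) (hn : 1 ≤ n) (z : ℤ) : (n : ℝ) * α ≠ z := by
  intro h
  have : Irrational ((n : ℝ) * α) := hα.natCast_mul (by omega)
  exact this.ne_int z h

lemma freq (α β : ℝ) (hα : Irrational α) : ∃ᶠ n : ℕ in atTop,
    (n : ℝ) * distInt ((n : ℝ) * α) * distInt ((n : ℝ) * β) ≤ 1 := by
  rw [frequently_atTop]
  intro n0
  obtain ⟨δ, hδ, hδ0⟩ : ∃ δ : ℝ, (∀ i : Fin n0, δ < distInt (((i + 1 : ℕ) : ℝ) * α)) ∧ 0 < δ := by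
    have h1 : ∀ᶠ δ in nhdsWithin (0 : ℝ) (Ioi 0),
        ∀ i : Fin n0, δ < distInt (((i + 1 : ℕ) : ℝ) * α) := by
      rw [eventually_all]
      intro i
      filter_upwards [Ioo_mem_nhdsGT (distInt_pos (((i + 1 : ℕ) : ℝ) * α)
        (irr_mul α hα _ (by omega)))] with x hx using hx.2
    have h2 : ∀ᶠ δ in nhdsWithin (0 : ℝ) (Ioi 0), 0 < δ := self_mem_nhdsWithin
    exact (h1.and h2).exists
  obtain ⟨N, hN⟩ := exists_nat_one_div_lt hδ0
  obtain ⟨k, hk0, hkN, hk⟩ := Real.exists_nat_abs_mul_sub_round_le α (n := N + 1) (by omega)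
  have hk' : distInt ((k : ℝ) * α) ≤ 1 / (((N + 1 : ℕ) : ℝ) + 1) := hk
  refine ⟨k, ?_, ?_⟩
  · by_contra hlt
    push Not at hlt
    have h1 := hδ ⟨k - 1, by omega⟩
    have e : k - 1 + 1 = k := by omega
    simp only [e] at h1
    have : (1 : ℝ) / (((N + 1 : ℕ) : ℝ) + 1) ≤ 1 / ((N : ℝ) + 1) := by
      push_cast
      gcongr
      linarith
    linarith
  · have h1 : (k : ℝ) * distInt ((k : ℝ) * α) ≤ 1 := by
      have hkr : (k : ℝ) ≤ ((N + 1 : ℕ) : ℝ) := by exact_mod_cast hkN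
      calc (k : ℝ) * distInt ((k : ℝ) * α) ≤ ((N + 1 : ℕ) : ℝ) * (1 / (((N + 1 : ℕ) : ℝ) + 1)) := by
            apply mul_le_mul hkr hk' (distInt_nonneg _) (by positivity)
        _ ≤ 1 := by
            rw [mul_one_div, div_le_one (by positivity)]; linarith
    have h2 : distInt ((k : ℝ) * β) ≤ 1 := (abs_sub_round _).trans (by norm_num)
    have h0 := distInt_nonneg ((k : ℝ) * β)
    have h0' : 0 ≤ (k : ℝ) * distInt ((k : ℝ) * α) := mul_nonneg (by positivity) (distInt_nonneg _)
    nlinarith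

lemma lw_small (α β : ℝ) (hα : Irrational α)
    (hl : Filter.liminf
        (fun n : ℕ => (n : ℝ) * distInt ((n : ℝ) * α) * distInt ((n : ℝ) * β))
        Filter.atTop = 0) (ε : ℝ) (hε : 0 < ε) :
    ∃ n : ℕ, 1 ≤ n ∧ (n : ℝ) * distInt ((n : ℝ) * α) * distInt ((n : ℝ) * β) < ε := by
  by_contra hcon
  push Not at hcon
  have h := Filter.le_liminf_of_le
    (f := atTop) (u := fun n : ℕ => (n : ℝ) * distInt ((n : ℝ) * α) * distInt ((n : ℝ) * β))
    (a := ε) (IsCoboundedUnder.of_frequently_le (freq α β hα))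
    (by filter_upwards [eventually_ge_atTop 1] with n hn using hcon n hn)
  rw [hl] at h
  linarith

lemma pigeon (α β : ℝ) (n : ℕ) (hn : 1 ≤ n) (A B : ℕ) (hAB : n < (A + 1) * (B + 1)) :
    ∃ m₁ m₂ : ℤ, ¬ (m₁ = 0 ∧ m₂ = 0) ∧ |m₁| ≤ A ∧ |m₂| ≤ B ∧
      distInt (m₁ * α + m₂ * β) ≤
        (A * distInt ((n : ℝ) * α) + B * distInt ((n : ℝ) * β)) / n := by
  have : NeZero n := ⟨by omega⟩
  set p := round ((n : ℝ) * α) with hp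
  set q := round ((n : ℝ) * β) with hq
  let f : Fin (A + 1) × Fin (B + 1) → ZMod n := fun x =>
    ((((x.1 : ℕ) : ℤ) * p + ((x.2 : ℕ) : ℤ) * q : ℤ) : ZMod n)
  obtain ⟨x, y, hxy, hf⟩ := Fintype.exists_ne_map_eq_of_card_lt f (by simpa [ZMod.card] using hAB)
  rw [ZMod.intCast_eq_intCast_iff_dvd_sub] at hf
  obtain ⟨t, ht⟩ := hf
  have hx1 := x.1.2
  have hx2 := x.2.2
  have hy1 := y.1.2
  have hy2 := y.2.2
  refine ⟨((y.1 : ℕ) : ℤ) - ((x.1 : ℕ) : ℤ), ((y.2 : ℕ) : ℤ) - ((x.2 : ℕ) : ℤ), ?_, ?_, ?_, ?_⟩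
  · rintro ⟨h1, h2⟩
    apply hxy
    ext <;> omega
  · rw [abs_le]; constructor <;> omega
  · rw [abs_le]; constructor <;> omega
  · have b1 : |((y.1 : ℕ) : ℤ) - ((x.1 : ℕ) : ℤ)| ≤ A := by rw [abs_le]; constructor <;> omega
    have b2 : |((y.2 : ℕ) : ℤ) - ((x.2 : ℕ) : ℤ)| ≤ B := by rw [abs_le]; constructor <;> omega
    set m₁ := ((y.1 : ℕ) : ℤ) - ((x.1 : ℕ) : ℤ)
    set m₂ := ((y.2 : ℕ) : ℤ) - ((x.2 : ℕ) : ℤ)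
    have ht' : m₁ * p + m₂ * q = n * t := by simp only [m₁, m₂]; linarith
    have htr : (m₁ : ℝ) * p + m₂ * q = n * t := by exact_mod_cast ht'
    have hn0 : (0 : ℝ) < n := by exact_mod_cast hn
    refine (distInt_le _ t).trans ?_
    have e : (m₁ : ℝ) * α + m₂ * β - t = (m₁ * (n * α - p) + m₂ * (n * β - q)) / n := by
      field_simp
      linarith
    rw [e, abs_div, abs_of_pos hn0]
    have b1' : |(m₁ : ℝ)| ≤ A := by exact_mod_cast b1
    have b2' : |(m₂ : ℝ)| ≤ B := by exact_mod_cast b2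
    gcongr
    refine (abs_add_le _ _).trans ?_
    rw [abs_mul, abs_mul]
    unfold distInt
    gcongr

lemma max_le_of (m : ℤ) (A : ℕ) (h : |m| ≤ A) (hA : 1 ≤ A) : (max 1 |(m : ℝ)|) ≤ A := by
  apply max_le
  · exact_mod_cast hA
  · exact_mod_cast h

lemma transfer (α β : ℝ) (hα : Irrational α)
    (hl : Filter.liminf
        (fun n : ℕ => (n : ℝ) * distInt ((n : ℝ) * α) * distInt ((n : ℝ) * β))
        Filter.atTop = 0) (ε : ℝ) (hε : 0 < ε) :
    ∃ m₁ m₂ : ℤ, ¬ (m₁ = 0 ∧ m₂ = 0) ∧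
      max 1 |(m₁ : ℝ)| * max 1 |(m₂ : ℝ)| * distInt (m₁ * α + m₂ * β) < ε := by
  obtain ⟨n, hn, hsm⟩ := lw_small α β hα hl ((ε / 2) ^ 2) (by positivity)
  have hn0 : (0 : ℝ) < n := by exact_mod_cast hn
  have hu := distInt_nonneg ((n : ℝ) * α)
  have hv := distInt_nonneg ((n : ℝ) * β)
  have hpg := pigeon α β n hn
  set u := distInt ((n : ℝ) * α)
  set v := distInt ((n : ℝ) * β)
  by_cases c1 : n * v ≤ u
  · obtain ⟨m₁, m₂, hm, h1, h2, h3⟩ := hpg 0 n (by omega)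
    refine ⟨m₁, m₂, hm, ?_⟩
    have hm1 : m₁ = 0 := by simpa using h1
    have hM2 := max_le_of m₂ n h2 hn
    have hd := distInt_nonneg ((m₁ : ℝ) * α + m₂ * β)
    have h4 : n * v < ε / 2 := by
      apply lt_of_pow_lt_pow_left₀ 2 (by positivity)
      nlinarith [mul_nonneg hn0.le hv]
    have h5 : ((0 : ℕ) * u + n * v) / n = v := by field_simp; simp
    rw [h5] at h3
    have : max 1 |(m₁ : ℝ)| = 1 := by simp [hm1]
    rw [this, one_mul]
    calc max 1 |(m₂ : ℝ)| * distInt (m₁ * α + m₂ * β) ≤ n * v :=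
          mul_le_mul hM2 h3 hd hn0.le
      _ < ε := by linarith
  by_cases c2 : n * u ≤ v
  · obtain ⟨m₁, m₂, hm, h1, h2, h3⟩ := hpg n 0 (by omega)
    refine ⟨m₁, m₂, hm, ?_⟩
    have hm2 : m₂ = 0 := by simpa using h2
    have hM1 := max_le_of m₁ n h1 hn
    have hd := distInt_nonneg ((m₁ : ℝ) * α + m₂ * β)
    have h4 : n * u < ε / 2 := by
      apply lt_of_pow_lt_pow_left₀ 2 (by positivity)
      nlinarith [mul_nonneg hn0.le hu]
    have h5 : (n * u + (0 : ℕ) * v) / n = u := by field_simp; simp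
    rw [h5] at h3
    have : max 1 |(m₂ : ℝ)| = 1 := by simp [hm2]
    rw [this, mul_one]
    calc max 1 |(m₁ : ℝ)| * distInt (m₁ * α + m₂ * β) ≤ n * u :=
          mul_le_mul hM1 h3 hd hn0.le
      _ < ε := by linarith
  · push Not at c1 c2
    have hv0 : 0 < v := by
      by_contra hh
      have : v = 0 := by linarith
      rw [this] at c1
      linarith
    have hu0 : 0 < u := by
      by_contra hh
      have : u = 0 := by linarith
      rw [this] at c2
      linarith
    set w := Real.sqrt (n * v / u) with hw
    have hw1 : 1 ≤ w := by
      apply Real.one_le_sqrt.2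
      rw [one_le_div hu0]; exact c1.le
    have hw0 : 0 < w := by linarith
    have hwsq : w ^ 2 = n * v / u := Real.sq_sqrt (by positivity)
    have hwn : w ≤ n := by
      apply Real.sqrt_le_iff.2 ⟨hn0.le, ?_⟩
      rw [div_le_iff₀ hu0]; nlinarith
    have hw2 : 1 ≤ n / w := by rw [one_le_div hw0]; exact hwn
    have hA : 1 ≤ ⌊w⌋₊ := Nat.one_le_floor_iff w |>.2 hw1
    have hB : 1 ≤ ⌊n / w⌋₊ := Nat.one_le_floor_iff _ |>.2 hw2
    have hAw : (⌊w⌋₊ : ℝ) ≤ w := Nat.floor_le hw0.le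
    have hBw : (⌊n / w⌋₊ : ℝ) ≤ n / w := Nat.floor_le (by positivity)
    obtain ⟨m₁, m₂, hm, h1, h2, h3⟩ := hpg ⌊w⌋₊ ⌊n / w⌋₊ (by
      have a1 := Nat.lt_floor_add_one w
      have a2 := Nat.lt_floor_add_one (n / w)
      have : (n : ℝ) < (⌊w⌋₊ + 1) * (⌊n / w⌋₊ + 1) := by
        calc (n : ℝ) = w * (n / w) := by field_simp
          _ < _ := mul_lt_mul'' a1 a2 hw0.le (by positivity)
      exact_mod_cast this)
    refine ⟨m₁, m₂, hm, ?_⟩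
    have hM1 := (max_le_of m₁ _ h1 hA).trans hAw
    have hM2 := (max_le_of m₂ _ h2 hB).trans hBw
    have hd := distInt_nonneg ((m₁ : ℝ) * α + m₂ * β)
    have hwu : w * u < ε / 2 := by
      apply lt_of_pow_lt_pow_left₀ 2 (by positivity)
      rw [mul_pow, hwsq]
      calc n * v / u * u ^ 2 = n * u * v := by field_simp
        _ < _ := hsm
    have hwv : n / w * v = w * u := by
      have : n * v = w ^ 2 * u := by rw [hwsq]; field_simp
      field_simp
      linarith
    have h4 : distInt ((m₁ : ℝ) * α + m₂ * β) ≤ (w * u + n / w * v) / n := by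
      refine h3.trans ?_
      gcongr
    rw [hwv] at h4
    calc max 1 |(m₁ : ℝ)| * max 1 |(m₂ : ℝ)| * distInt (m₁ * α + m₂ * β)
        ≤ w * (n / w) * ((w * u + w * u) / n) := by gcongr
      _ = 2 * (w * u) := by field_simp; ring
      _ < ε := by linarith
lemma Lf_neg {d r : ℕ} (α : Fin r → Fin d → ℝ) (m : Fin d → ℤ) (i : Fin r) :
    Lf α (-m) i = -Lf α m i := by
  simp [Lf]

lemma Lf_single {d r : ℕ} (α : Fin r → Fin d → ℝ) (j : Fin d) (t : ℤ) (i : Fin r) :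
    Lf α (Pi.single j t) i = α i j * t := by
  simp only [Lf]
  rw [Finset.sum_eq_single j]
  · simp
  · intro b _ hb; simp [hb]
  · simp

/-- Consequence of linear repetitivity in terms of `distInt`. -/
def KeyProp {d r : ℕ} (α : Fin r → Fin d → ℝ) (K : ℝ) : Prop :=
  ∀ M : Fin d → ℕ, (∀ j, 1 ≤ M j) → ∀ q : Fin r → ℕ, (∀ i, 1 ≤ q i) →
      (∀ i, q i = 1 ∨ ∃ m : Fin d → ℤ, (∀ j, |m j| ≤ M j) ∧ (∀ z : ℤ, Lf α m i ≠ z) ∧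
        2 * q i * distInt (Lf α m i) ≤ 1) →
      ∏ i, (q i : ℝ) ≤ K * ∏ j, (M j : ℝ)

lemma key' {d r : ℕ} (α : Fin r → Fin d → ℝ) (K : ℝ)
    (h : ∀ M : Fin d → ℕ, (∀ j, 1 ≤ M j) → ∀ q : Fin r → ℕ, (∀ i, 1 ≤ q i) →
      (∀ i, q i = 1 ∨ ∃ m : Fin d → ℤ, (∀ j, |m j| ≤ M j) ∧ 0 < Int.fract (-Lf α m i) ∧
        2 * q i * Int.fract (-Lf α m i) ≤ 1) →
      ∏ i, (q i : ℝ) ≤ K * ∏ j, (M j : ℝ)) : KeyProp α K := by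
  intro M hM q hq hh
  refine h M hM q hq fun i => ?_
  rcases hh i with h1 | ⟨m, hm, hz, hd⟩
  · exact Or.inl h1
  · right
    have hne : Int.fract (Lf α m i) ≠ 0 := by
      intro h0
      apply hz ⌊Lf α m i⌋
      have := Int.fract_add_floor (Lf α m i)
      rw [h0] at this
      linarith
    have hpos : 0 < Int.fract (Lf α m i) := lt_of_le_of_ne (Int.fract_nonneg _) hne.symm
    rw [distInt, abs_sub_round_eq_min] at hd
    rcases min_choice (Int.fract (Lf α m i)) (1 - Int.fract (Lf α m i)) with hc | hc
    · refine ⟨-m, by simpa using hm, ?_⟩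
      rw [Lf_neg, neg_neg]
      rw [hc] at hd
      exact ⟨hpos, hd⟩
    · refine ⟨m, hm, ?_⟩
      rw [hc] at hd
      rw [Int.fract_neg hne]
      exact ⟨by linarith [Int.fract_lt_one (Lf α m i)], hd⟩

lemma common_den {ι : Type*} [Fintype ι] (f : ι → ℝ) (hf : ∀ i, ¬ Irrational (f i)) :
    ∃ Q : ℕ, 1 ≤ Q ∧ ∀ i, ∃ z : ℤ, (Q : ℝ) * f i = z := by
  classical
  have : ∀ i, ∃ x : ℚ, (x : ℝ) = f i := by
    intro i
    have := hf i
    unfold Irrational at this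
    push Not at this
    exact this
  choose x hx using this
  refine ⟨∏ i, (x i).den, Finset.prod_pos fun i _ => (x i).pos, fun i => ?_⟩
  obtain ⟨c, hc⟩ := Finset.dvd_prod_of_mem (fun i => (x i).den) (Finset.mem_univ i)
  refine ⟨c * (x i).num, ?_⟩
  rw [hc, ← hx i]
  have hden : ((x i).den : ℝ) * (x i : ℝ) = (x i).num := by
    have := Rat.den_mul_eq_num (x i)
    exact_mod_cast this
  push_cast
  calc ((x i).den : ℝ) * c * (x i : ℝ) = c * (((x i).den : ℝ) * (x i : ℝ)) := by ring
    _ = _ := by rw [hden]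

lemma final {d r : ℕ} (α : Fin r → Fin d → ℝ)
    (hD : ∀ (t : Fin r → ℝ) (ε : ℝ), 0 < ε →
      ∃ (m : Fin d → ℤ) (p : Fin r → ℤ), ∀ i, |(p i : ℝ) - Lf α m i - t i| < ε)
    (hA : ∀ m : Fin d → ℤ, (∀ i, ∃ p : ℤ, Lf α m i = p) → m = 0)
    (K : ℝ) (hK : 0 < K) (hkey : KeyProp α K)
    (hl : ∀ α β : ℝ, Filter.liminf
        (fun n : ℕ => (n : ℝ) * distInt ((n : ℝ) * α) * distInt ((n : ℝ) * β))
        Filter.atTop = 0) (hrd : r ≠ d) : False := by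
  -- at most one irrational per column
  have stepA : ∀ j i l, Irrational (α i j) → Irrational (α l j) → i = l := by
    intro j i l hi hl
    by_contra hne
    have main : ∀ q : ℕ, 1 ≤ q → (q : ℝ) * q ≤ K * (2 * q) := by
      intro q hq
      have hex : ∀ i', Irrational (α i' j) → ∃ m : Fin d → ℤ,
          (∀ j', |m j'| ≤ ((if j' = j then 2 * q else 1 : ℕ) : ℤ)) ∧
          (∀ z : ℤ, Lf α m i' ≠ z) ∧ 2 * q * distInt (Lf α m i') ≤ 1 := by
        intro i' hi'
        obtain ⟨t, ht0, ht, hd⟩ := Real.exists_nat_abs_mul_sub_round_le (α i' j) (n := 2 * q) (by omega)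
        refine ⟨Pi.single j (t : ℤ), fun j' => ?_, ?_, ?_⟩
        · by_cases hj : j' = j
          · subst hj; simp; exact_mod_cast ht
          · simp [hj]
        · intro z
          rw [Lf_single, mul_comm]
          exact irr_mul _ hi' t ht0 z
        · rw [Lf_single, mul_comm (α i' j)]
          have hd' : distInt ((t : ℝ) * α i' j) ≤ 1 / (((2 * q : ℕ) : ℝ) + 1) := hd
          have hq0 : (0 : ℝ) < q := by exact_mod_cast hq
          push_cast at hd' ⊢
          rw [le_div_iff₀ (by positivity)] at hd'
          nlinarith [distInt_nonneg ((t : ℝ) * α i' j)]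
      have := hkey (fun j' => if j' = j then 2 * q else 1)
        (fun j' => by split_ifs <;> omega)
        (fun i' => (if i' = i then q else 1) * (if i' = l then q else 1))
        (fun i' => by split_ifs <;> nlinarith)
        (by
          intro i'
          by_cases h1 : i' = i
          · right
            subst h1
            simpa [hne] using hex i' hi
          · by_cases h2 : i' = l
            · right
              subst h2
              simpa [h1] using hex i' hl
            · left; simp [h1, h2])
      push_cast at this
      rw [Finset.prod_mul_distrib] at this
      simpa using this
    obtain ⟨q, hq⟩ := exists_nat_gt (2 * K)
    have hq0 : (0 : ℝ) < q := by linarith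
    have := main q (by exact_mod_cast hq0)
    nlinarith
  -- every row has an irrational
  have stepB : ∀ l, ∃ j, Irrational (α l j) := by
    intro l
    by_contra hcon
    push Not at hcon
    obtain ⟨Q, hQ, hz⟩ := common_den (α l) hcon
    choose z hz using hz
    have hQ0 : (0 : ℝ) < Q := by exact_mod_cast hQ
    obtain ⟨m, p, hmp⟩ := hD (fun _ => 1 / (2 * Q)) (1 / (4 * Q)) (by positivity)
    have h1 := hmp l
    have e : (Q : ℝ) * ((p l : ℝ) - Lf α m l) = ((Q * p l - ∑ j, z j * m j : ℤ) : ℝ) := by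
      push_cast
      rw [mul_sub, Lf, Finset.mul_sum]
      congr 1
      apply Finset.sum_congr rfl
      intro j _
      rw [← hz j]; ring
    set y : ℤ := Q * p l - ∑ j, z j * m j
    rw [abs_lt] at h1
    have a1 : (Q : ℝ) * (1 / (2 * Q)) = 1 / 2 := by field_simp
    have a2 : (Q : ℝ) * (1 / (4 * Q)) = 1 / 4 := by field_simp
    have b1 := mul_lt_mul_of_pos_left h1.1 hQ0
    have b2 := mul_lt_mul_of_pos_left h1.2 hQ0
    have b3 : (Q : ℝ) * ((p l : ℝ) - Lf α m l - 1 / (2 * Q)) = y - 1 / 2 := by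
      rw [mul_sub, e, a1]
    rw [b3] at b1 b2
    have c1 : (0 : ℝ) < y := by linarith
    have c2 : (y : ℝ) < 1 := by linarith
    have c1' : 0 < y := by exact_mod_cast c1
    have c2' : y < 1 := by exact_mod_cast c2
    omega
  have stepC : ∀ j, ∃ l, Irrational (α l j) := by
    intro j
    by_contra hcon
    push Not at hcon
    obtain ⟨Q, hQ, hz⟩ := common_den (fun l => α l j) hcon
    have := hA (Pi.single j (Q : ℤ)) (fun i => by
      obtain ⟨z, hz⟩ := hz i
      refine ⟨z, ?_⟩
      rw [Lf_single, ← hz]; push_cast; ring)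
    have := congrFun this j
    simp at this
    omega
  choose g hg using stepB
  choose f hf using stepC
  have hle : r ≤ d := by
    have hinj : Function.Injective g := by
      intro a b hab
      apply stepA (g a) a b (hg a)
      rw [hab]; exact hg b
    simpa using Fintype.card_le_of_injective g hinj
  obtain ⟨j₁, j₂, hj, hff⟩ := Fintype.exists_ne_map_eq_of_card_lt f (by simp; omega)
  set i := f j₁ with hi
  have hi1 : Irrational (α i j₁) := hf j₁
  have hi2 : Irrational (α i j₂) := by rw [hff]; exact hf j₂
  obtain ⟨Q₁, hQ₁, hz₁⟩ := common_den (fun l => if l = i then 0 else α l j₁) (by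
    intro l
    by_cases h : l = i
    · simp [h]
    · simp only [h, if_false]
      intro hirr
      exact h (stepA j₁ l i hirr hi1))
  obtain ⟨Q₂, hQ₂, hz₂⟩ := common_den (fun l => if l = i then 0 else α l j₂) (by
    intro l
    by_cases h : l = i
    · simp [h]
    · simp only [h, if_false]
      intro hirr
      exact h (stepA j₂ l i hirr hi2))
  obtain ⟨m₁, m₂, hm, hsm⟩ := transfer (α i j₁) (α i j₂) hi1 (hl _ _) (1 / (4 * K)) (by positivity)
  let m : Fin d → ℤ := Pi.single j₁ m₁ + Pi.single j₂ m₂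
  have hLm : ∀ l, Lf α m l = α l j₁ * m₁ + α l j₂ * m₂ := by
    intro l
    rw [Lf_add, Lf_single, Lf_single]
  have hnz : ∀ z : ℤ, Lf α m i ≠ z := by
    intro z hzz
    let m' : Fin d → ℤ := Pi.single j₁ ((Q₁ * Q₂ : ℤ) * m₁) + Pi.single j₂ ((Q₁ * Q₂ : ℤ) * m₂)
    have h0 : m' = 0 := by
      apply hA
      intro l
      rw [Lf_add, Lf_single, Lf_single]
      by_cases h : l = i
      · subst h
        refine ⟨Q₁ * Q₂ * z, ?_⟩
        rw [hLm] at hzz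
        push_cast
        rw [← hzz]; ring
      · obtain ⟨y₁, hy₁⟩ := hz₁ l
        obtain ⟨y₂, hy₂⟩ := hz₂ l
        simp only [h, if_false] at hy₁ hy₂
        refine ⟨y₁ * Q₂ * m₁ + y₂ * Q₁ * m₂, ?_⟩
        push_cast
        rw [← hy₁, ← hy₂]; ring
    have hne' : j₂ ≠ j₁ := hj.symm
    have e1 := congrFun h0 j₁
    have e2 := congrFun h0 j₂
    simp [m', hj, hne', show Q₁ ≠ 0 by omega, show Q₂ ≠ 0 by omega] at e1 e2
    exact hm ⟨e1, e2⟩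
  have hτ0 : 0 < distInt (Lf α m i) := distInt_pos _ hnz
  have hτ1 : distInt (Lf α m i) ≤ 1 / 2 := abs_sub_round _
  have hτe : distInt (m₁ * α i j₁ + m₂ * α i j₂) = distInt (Lf α m i) := by
    rw [hLm]; congr 1; ring
  rw [hτe] at hsm
  set τ := distInt (Lf α m i) with hτ
  have h1q : 1 ≤ 1 / (2 * τ) := by
    rw [le_div_iff₀ (by positivity)]; linarith
  set q := ⌊1 / (2 * τ)⌋₊ with hqdef
  have hq1 : 1 ≤ q := (Nat.one_le_floor_iff _).2 h1q
  have hqle : (q : ℝ) ≤ 1 / (2 * τ) := Nat.floor_le (by positivity)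
  have hqlt : 1 / (2 * τ) < q + 1 := Nat.lt_floor_add_one _
  have hfin := hkey
    (fun j => (if j = j₁ then max 1 m₁.natAbs else 1) * (if j = j₂ then max 1 m₂.natAbs else 1))
    (fun j => by
      have := le_max_left 1 m₁.natAbs
      have := le_max_left 1 m₂.natAbs
      split_ifs <;> nlinarith)
    (fun l => if l = i then q else 1)
    (fun l => by split_ifs <;> omega)
    (by
      intro l
      by_cases h : l = i
      · right
        subst h
        refine ⟨m, fun j => ?_, hnz, ?_⟩
        · by_cases c1 : j = j₁
          · subst c1
            simp [m, hj]
          · by_cases c2 : j = j₂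
            · subst c2
              simp [m, c1]
            · simp [m, c1, c2]
        · simp only [if_true]
          rw [le_div_iff₀ (by positivity)] at hqle
          linarith
      · left; simp [h])
  push_cast at hfin
  rw [Finset.prod_mul_distrib] at hfin
  simp only [Finset.prod_ite_eq', Finset.mem_univ, if_true] at hfin
  have ea : ∀ t : ℤ, ((t.natAbs : ℕ) : ℝ) = |(t : ℝ)| := fun t => by
    rw [Nat.cast_natAbs]; simp
  rw [ea, ea] at hfin
  rw [lt_div_iff₀ (by positivity)] at hsm
  rw [div_lt_iff₀ (by positivity)] at hqlt
  have hq1' : (1 : ℝ) ≤ q := by exact_mod_cast hq1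
  have h6 : 1 ≤ 4 * τ * q := by nlinarith
  have h7 := mul_le_mul_of_nonneg_left hfin (by positivity : 0 ≤ 4 * τ)
  linarith

end LWProof

/-- Assuming the Littlewood conjecture, for every `d ≥ 1` and every
integer `k > d` with `k ≠ 2d`, there is no `k` to `d` cubical cut and project set
which is `LR_Ω` with respect to `ℛ_d`. -/
theorem littlewood_implies_no_cubical_LROmega_wrt_Rd
    (littlewood : ∀ α β : ℝ,
      Filter.liminf
        (fun n : ℕ => (n : ℝ) * distInt ((n : ℝ) * α) * distInt ((n : ℝ) * β))
        Filter.atTop = 0)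
    (k d : ℕ) (hd : 1 ≤ d) (hkd : d < k) (hne : k ≠ 2 * d)
    (𝒟 : CPS k d) (h : 𝒟.IsCubicalCPSet) :
    ¬ 𝒟.IsLROmega (RdCollection d) := by
  obtain ⟨r, rfl⟩ := Nat.exists_eq_add_of_le hkd.le
  intro hLR
  obtain ⟨hc, _, hap⟩ := h
  obtain ⟨α, hα⟩ := LWProof.exists_graph 𝒟
  have hD := LWProof.dens 𝒟 hα
  obtain ⟨K, hK, hkey⟩ := LWProof.key α (LWProof.gmap α 𝒟.s) hD (LWProof.lr_main 𝒟 hα hc hLR)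
  exact LWProof.final α hD (LWProof.aper 𝒟 hα hc hap) K hK (LWProof.key' α K hkey)
    littlewood (by omega)
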